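/- arXiv:0805.3767 — 4 statements merged into one kernel-verified Lean document; each statement's English description precedes it below -/
import Mathlib

section
/- There exists δ₀ > 0 such that for every δ with 0 < δ < δ₀ there are α > 0 and an integer L₀ with the following property. For every integer L > L₀ and every eigenvalue λ ∈ [−2δ, 2δ] of H_Λ, where Λ = ([−L²+1, L²−1] ∩ ℤ)², either there is an eigenvalue μ of H_{Λ₀}, with Λ₀ = ([−L₀²+1, L₀²−1] ∩ ℤ)², such that |λ − μ| ≤ e^{−αL₀}, or there are (j,n) ∈ P with L₀ ≤ |j| < L, an admissible L_j, and an eigenvalue λ_j ∈ [−2δ, 2δ] of H_{Λ_j} such that |λ − λ_j| ≤ e^{−α|j|}. -/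
noncomputable section

/-- The finite-volume Floquet Hamiltonian `H_S` on a finite set `S ⊆ ℤ × ℤ`:
diagonal entries `n + j²`, entries `δ` between `(j,n)` and `(j',n')` with
`|j−j'| = 1` and `|n−n'| = 1`, all other entries `0`. -/
def Hmat (δ : ℝ) (S : Finset (ℤ × ℤ)) : Matrix S S ℝ := fun x y =>
  if (x : ℤ × ℤ) = (y : ℤ × ℤ) then (((x : ℤ × ℤ).2 + (x : ℤ × ℤ).1 ^ 2 : ℤ) : ℝ)
  else if |(x : ℤ × ℤ).1 - (y : ℤ × ℤ).1| = 1 ∧ |(x : ℤ × ℤ).2 - (y : ℤ × ℤ).2| = 1 then δ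
  else 0

/-- `μ` is an eigenvalue of the real symmetric matrix `H_S`. -/
def IsEigen (δ : ℝ) (S : Finset (ℤ × ℤ)) (μ : ℝ) : Prop :=
  ∃ v : S → ℝ, v ≠ 0 ∧ (Hmat δ S).mulVec v = μ • v

/-- The square `Λ_j` of side `2L` centered at `(j, n)`. -/
def sqΛ (j n L : ℤ) : Finset (ℤ × ℤ) :=
  Finset.Icc (j - L) (j + L) ×ˢ Finset.Icc (n - L) (n + L)

/-- The square `([−m, m] ∩ ℤ)²` as a finite subset of `ℤ × ℤ`. -/
def bigSq (m : ℤ) : Finset (ℤ × ℤ) := Finset.Icc (-m) m ×ˢ Finset.Icc (-m) m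

/-- Sum of `f` over the four diagonal neighbours of `x`. -/
def diagSum (f : ℤ × ℤ → ℝ) (x : ℤ × ℤ) : ℝ :=
  f (x.1 + 1, x.2 + 1) + f (x.1 + 1, x.2 - 1) + f (x.1 - 1, x.2 + 1) + f (x.1 - 1, x.2 - 1)

/-- The diagonal potential `n + j²`. -/
def pot (x : ℤ × ℤ) : ℤ := x.2 + x.1 ^ 2

/-- `y` is one of the four diagonal neighbours of `x`. -/
def DiagAdj (x y : ℤ × ℤ) : Prop := |x.1 - y.1| = 1 ∧ |x.2 - y.2| = 1

lemma Hmat_apply_eq (δ : ℝ) (S : Finset (ℤ × ℤ)) (x y : S) :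
    Hmat δ S x y = (if (y : ℤ × ℤ) = x then ((pot x : ℤ) : ℝ) else 0)
      + (if (y : ℤ × ℤ) = (x.1.1 + 1, x.1.2 + 1) then δ else 0)
      + (if (y : ℤ × ℤ) = (x.1.1 + 1, x.1.2 - 1) then δ else 0)
      + (if (y : ℤ × ℤ) = (x.1.1 - 1, x.1.2 + 1) then δ else 0)
      + (if (y : ℤ × ℤ) = (x.1.1 - 1, x.1.2 - 1) then δ else 0) := by
  obtain ⟨⟨a, b⟩, hx⟩ := x
  obtain ⟨⟨c, d⟩, hy⟩ := y
  simp only [Hmat, pot, Prod.mk.injEq, abs_eq (zero_le_one (α := ℤ))]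
  split_ifs <;> first | omega | simp

lemma Hmat_mulVec (δ : ℝ) (S : Finset (ℤ × ℤ)) (f : ℤ × ℤ → ℝ) (hf : ∀ x ∉ S, f x = 0) (x : S) :
    (Hmat δ S).mulVec (fun y => f y) x = pot x * f x + δ * diagSum f x := by
  have key : ∀ (p : ℤ × ℤ) (c : ℝ),
      ∑ y : S, (if (y : ℤ × ℤ) = p then c else 0) * f y = c * f p := by
    intro p c
    rw [Finset.sum_coe_sort S (fun y => (if y = p then c else 0) * f y)]
    simp only [ite_mul, zero_mul, Finset.sum_ite_eq']
    split_ifs with h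
    · rfl
    · rw [hf p h, mul_zero]
  simp only [Matrix.mulVec, dotProduct, Hmat_apply_eq, add_mul, Finset.sum_add_distrib, key,
    diagSum]
  ring

lemma Hmat_isHermitian (δ : ℝ) (S : Finset (ℤ × ℤ)) : (Hmat δ S).IsHermitian := by
  refine Matrix.IsHermitian.ext fun x y => ?_
  simp only [Hmat, star_trivial]
  by_cases h : x = y
  · subst h; rfl
  · have h1 : (x : ℤ × ℤ) ≠ y := fun e => h (Subtype.ext e)
    rw [if_neg h1, if_neg h1.symm, abs_sub_comm, abs_sub_comm (y : ℤ × ℤ).2]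

/-- An eigenvector of `H_S`, extended by zero to all of `ℤ × ℤ`. -/
lemma IsEigen.exists_extension {δ μ : ℝ} {S : Finset (ℤ × ℤ)} (h : IsEigen δ S μ) :
    ∃ f : ℤ × ℤ → ℝ, (∀ x ∉ S, f x = 0) ∧ (∃ x ∈ S, f x ≠ 0) ∧
      ∀ x ∈ S, pot x * f x + δ * diagSum f x = μ * f x := by
  obtain ⟨v, hv, hev⟩ := h
  have hS : ∀ x ∉ S, (fun x => if h : x ∈ S then v ⟨x, h⟩ else 0) x = 0 :=
    fun x hx => dif_neg hx
  have hres : (fun y : S => (fun x => if h : x ∈ S then v ⟨x, h⟩ else 0) (y : ℤ × ℤ)) = v := by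
    funext y; simp
  refine ⟨fun x => if h : x ∈ S then v ⟨x, h⟩ else 0, hS, ?_, fun x hx => ?_⟩
  · obtain ⟨y, hy⟩ := Function.ne_iff.mp hv
    exact ⟨y, y.2, by simpa using hy⟩
  · rw [← Hmat_mulVec δ S _ hS ⟨x, hx⟩, hres, hev]
    simp [hx]

/-- An approximate eigenvector of a symmetric matrix yields a nearby eigenvalue. -/
lemma Matrix.IsHermitian.exists_eigenvalue_near {ι : Type*} [Fintype ι] {A : Matrix ι ι ℝ}
    (hA : A.IsHermitian) (lam : ℝ) (v : ι → ℝ) (hv : v ≠ 0) :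
    ∃ μ : ℝ, (∃ w : ι → ℝ, w ≠ 0 ∧ A.mulVec w = μ • w) ∧
      (lam - μ) ^ 2 * ∑ i, v i ^ 2 ≤ ∑ i, (A.mulVec v i - lam * v i) ^ 2 := by
  classical
  obtain ⟨i₀, -⟩ := Function.ne_iff.mp hv
  have : Nonempty ι := ⟨i₀⟩
  obtain ⟨k, hk⟩ := Finite.exists_min fun i => (lam - hA.eigenvalues i) ^ 2
  refine ⟨hA.eigenvalues k, ⟨hA.eigenvectorBasis k, ?_, hA.mulVec_eigenvectorBasis k⟩, ?_⟩
  · intro h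
    apply hA.eigenvectorBasis.orthonormal.ne_zero k
    ext i
    exact congrFun h i
  · set b := hA.eigenvectorBasis with hb
    have h1 := b.sum_sq_norm_inner_right (WithLp.toLp 2 v)
    have h2 := b.sum_sq_norm_inner_right (WithLp.toLp 2 (A.mulVec v - lam • v))
    rw [EuclideanSpace.norm_sq_eq] at h1 h2
    simp only [Real.norm_eq_abs, sq_abs, Pi.sub_apply, Pi.smul_apply, smul_eq_mul] at h1 h2
    rw [← h1, ← h2, Finset.mul_sum]
    refine Finset.sum_le_sum fun i _ => ?_
    have h3 : inner ℝ (b i) (WithLp.toLp 2 (A.mulVec v - lam • v))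
        = (hA.eigenvalues i - lam) * inner ℝ (b i) (WithLp.toLp 2 v) := by
      have e : ∀ u : ι → ℝ, inner ℝ (b i) (WithLp.toLp 2 u) = u ⬝ᵥ (b i).ofLp := by
        intro u
        rw [EuclideanSpace.inner_eq_star_dotProduct]
        simp
      have hAT : A.transpose = A := by simpa using hA.eq
      rw [e, e, sub_dotProduct, smul_dotProduct, dotProduct_comm, Matrix.dotProduct_mulVec,
        ← Matrix.mulVec_transpose, hAT, hA.mulVec_eigenvectorBasis i, smul_dotProduct,
        dotProduct_comm, smul_eq_mul, smul_eq_mul]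
      ring
    rw [h3, mul_pow, ← sub_sq_comm lam]
    exact mul_le_mul_of_nonneg_right (hk i) (sq_nonneg _)

lemma abs_diagSum_le {f : ℤ × ℤ → ℝ} {x : ℤ × ℤ} {B : ℝ} (h : ∀ y, DiagAdj x y → |f y| ≤ B) :
    |diagSum f x| ≤ 4 * B := by
  have h1 := h (x.1 + 1, x.2 + 1) (by simp [DiagAdj])
  have h2 := h (x.1 + 1, x.2 - 1) (by simp [DiagAdj])
  have h3 := h (x.1 - 1, x.2 + 1) (by simp [DiagAdj])
  have h4 := h (x.1 - 1, x.2 - 1) (by simp [DiagAdj])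
  rw [abs_le] at *
  unfold diagSum
  constructor <;> linarith

/-- Off the resonant parabola, an eigenfunction is small compared to its neighbours. -/
lemma abs_le_of_pot_ne_zero {δ μ B : ℝ} {f : ℤ × ℤ → ℝ} {x : ℤ × ℤ} (hδ : 0 < δ)
    (hμ : |μ| ≤ 1 / 2) (hx : pot x ≠ 0) (hB : 0 ≤ B)
    (hf : f x = 0 ∨ pot x * f x + δ * diagSum f x = μ * f x)
    (h : ∀ y, DiagAdj x y → |f y| ≤ B) : |f x| ≤ 8 * δ * B := by
  rcases hf with hf | hf
  · rw [hf, abs_zero]; positivity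
  · have h1 : (1 : ℝ) ≤ |(pot x : ℝ)| := by exact_mod_cast Int.one_le_abs hx
    have h2 : (1 : ℝ) / 2 ≤ |(pot x : ℝ) - μ| := by
      have := abs_sub_abs_le_abs_sub (pot x : ℝ) μ
      linarith
    have h3 : |(pot x : ℝ) - μ| * |f x| = δ * |diagSum f x| := by
      have h4 : (pot x - μ) * f x = -(δ * diagSum f x) := by linarith
      rw [← abs_mul, h4, abs_neg, abs_mul, abs_of_pos hδ]
    have h4 := mul_le_mul_of_nonneg_left (abs_diagSum_le h) hδ.le
    have h5 := mul_le_mul_of_nonneg_right h2 (abs_nonneg (f x))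
    linarith

/-- Every point of the resonant parabola is at distance at least `k` from `x`. -/
def FarFromParabola (k : ℕ) (x : ℤ × ℤ) : Prop :=
  ∀ j : ℤ, (k : ℤ) ≤ |x.1 - j| ∨ (k : ℤ) ≤ |x.2 + j ^ 2|

lemma FarFromParabola.of_adj {k : ℕ} {x y : ℤ × ℤ} (h : FarFromParabola (k + 1) x)
    (hxy : DiagAdj x y) : FarFromParabola k y := by
  intro j
  obtain ⟨h1, h2⟩ := hxy
  have h3 := h j
  push_cast at h3
  generalize j ^ 2 = s at *
  rcases h3 with h3 | h3
  · left; rw [le_abs] at *; rw [abs_eq zero_le_one] at h1; omega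
  · right; rw [le_abs] at *; rw [abs_eq zero_le_one] at h2; omega

lemma FarFromParabola.pot_ne_zero {k : ℕ} {x : ℤ × ℤ} (h : FarFromParabola (k + 1) x) :
    pot x ≠ 0 := by
  intro h0
  have h1 := h x.1
  unfold pot at h0
  rw [h0, sub_self, abs_zero] at h1
  push_cast at h1
  omega

/-- Exponential decay of eigenfunctions away from the resonant parabola. -/
lemma abs_le_of_farFromParabola {δ μ M : ℝ} {f : ℤ × ℤ → ℝ} (hδ : 0 < δ) (hδ' : δ < 1 / 512)
    (hμ : |μ| ≤ 1 / 2) (hM : ∀ x, |f x| ≤ M)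
    (hf : ∀ x, f x = 0 ∨ pot x * f x + δ * diagSum f x = μ * f x) (k : ℕ) :
    ∀ x, FarFromParabola k x → |f x| ≤ (1 / 64) ^ k * M := by
  have hM0 : 0 ≤ M := (abs_nonneg _).trans (hM 0)
  induction k with
  | zero => intro x _; simpa using hM x
  | succ k ih =>
    intro x hx
    have h1 := abs_le_of_pot_ne_zero hδ hμ hx.pot_ne_zero (by positivity) (hf x)
      fun y hy => ih y (hx.of_adj hy)
    refine h1.trans ?_
    rw [pow_succ', mul_assoc (1 / 64 : ℝ)]
    exact mul_le_mul_of_nonneg_right (by linarith) (by positivity)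

/-- Truncating an eigenfunction to a region on whose boundary it is small yields a nearby
eigenvalue of `H_S`. -/
lemma exists_isEigen_near {δ lam ε : ℝ} {f : ℤ × ℤ → ℝ} {S T : Finset (ℤ × ℤ)} {x₀ : ℤ × ℤ}
    (hδ : 0 < δ) (hTS : T ⊆ S) (hx₀ : x₀ ∈ T) (hfx₀ : f x₀ ≠ 0) (hε : 0 ≤ ε)
    (hf : ∀ x ∈ T, pot x * f x + δ * diagSum f x = lam * f x)
    (hbd : ∀ x ∈ T, ∀ y ∉ T, DiagAdj x y → |f x| ≤ ε ∧ |f y| ≤ ε) :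
    ∃ μ, IsEigen δ S μ ∧ (lam - μ) ^ 2 * f x₀ ^ 2 ≤ S.card * (4 * δ * ε) ^ 2 := by
  classical
  set g : ℤ × ℤ → ℝ := fun x => if x ∈ T then f x else 0 with hg
  have hgS : ∀ x ∉ S, g x = 0 := fun x hx => if_neg fun h => hx (hTS h)
  have hgx₀ : g x₀ = f x₀ := if_pos hx₀
  obtain ⟨μ, hμ, hle⟩ := (Hmat_isHermitian δ S).exists_eigenvalue_near lam (fun y : S => g y)
    (fun h => hfx₀ (hgx₀ ▸ congrFun h ⟨x₀, hTS hx₀⟩))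
  refine ⟨μ, hμ, ?_⟩
  have hlow : f x₀ ^ 2 ≤ ∑ i : S, g i ^ 2 := by
    rw [← hgx₀]
    exact Finset.single_le_sum (f := fun i : S => g i ^ 2) (fun i _ => sq_nonneg _)
      (Finset.mem_univ (⟨x₀, hTS hx₀⟩ : S))
  have hres : ∀ x : S, |(Hmat δ S).mulVec (fun y : S => g y) x - lam * g x| ≤ 4 * δ * ε := by
    intro x
    rw [Hmat_mulVec δ S g hgS]
    by_cases hx : (x : ℤ × ℤ) ∈ T
    · have hgx : g x = f x := if_pos hx
      have h1 : |diagSum (fun y => g y - f y) x| ≤ 4 * ε := by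
        refine abs_diagSum_le fun y hy => ?_
        by_cases hyT : y ∈ T
        · simpa [hg, hyT] using hε
        · simpa [hg, hyT] using (hbd x hx y hyT hy).2
      have h2 : pot x * g x + δ * diagSum g x - lam * g x
          = δ * diagSum (fun y => g y - f y) x := by
        rw [hgx, ← hf x hx]; unfold diagSum; ring
      rw [h2, abs_mul, abs_of_pos hδ]
      nlinarith
    · have hgx : g x = 0 := if_neg hx
      have h1 : |diagSum g x| ≤ 4 * ε := by
        refine abs_diagSum_le fun y hy => ?_
        by_cases hyT : y ∈ T
        · have hyx : DiagAdj y x := by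
            unfold DiagAdj at *
            rwa [abs_sub_comm, abs_sub_comm y.2]
          simpa [hg, hyT] using (hbd y hyT x hx hyx).1
        · simpa [hg, hyT] using hε
      rw [hgx, mul_zero, mul_zero, zero_add, sub_zero, abs_mul, abs_of_pos hδ]
      nlinarith
  calc (lam - μ) ^ 2 * f x₀ ^ 2 ≤ (lam - μ) ^ 2 * ∑ i : S, g i ^ 2 := by gcongr
    _ ≤ _ := hle
    _ ≤ ∑ _i : S, (4 * δ * ε) ^ 2 := Finset.sum_le_sum fun i _ => sq_le_sq'
        (abs_le.mp (hres i)).1 (abs_le.mp (hres i)).2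
    _ = S.card * (4 * δ * ε) ^ 2 := by simp

/-- Quantitative form of `exists_isEigen_near` for an eigenfunction that is maximal at `x₀`. -/
lemma exists_isEigen_near_of_farFromParabola {δ lam : ℝ} {f : ℤ × ℤ → ℝ}
    {S T : Finset (ℤ × ℤ)} {x₀ : ℤ × ℤ} {k N : ℕ} (hδ : 0 < δ) (hδ' : δ < 1 / 512)
    (hlam : |lam| ≤ 1 / 2) (hTS : T ⊆ S) (hx₀ : x₀ ∈ T) (hfx₀ : f x₀ ≠ 0)
    (hM : ∀ x, |f x| ≤ |f x₀|)
    (hf : ∀ x, f x = 0 ∨ pot x * f x + δ * diagSum f x = lam * f x)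
    (hfT : ∀ x ∈ T, pot x * f x + δ * diagSum f x = lam * f x)
    (hbd : ∀ x ∈ T, ∀ y ∉ T, DiagAdj x y → FarFromParabola k x ∧ FarFromParabola k y)
    (hcard : S.card = N ^ 2) :
    ∃ μ, IsEigen δ S μ ∧ |lam - μ| ≤ N * (1 / 64) ^ k / 128 := by
  have hdec := abs_le_of_farFromParabola hδ hδ' hlam hM hf k
  have hpos : 0 < |f x₀| := abs_pos.mpr hfx₀
  obtain ⟨μ, hμ, hle⟩ := exists_isEigen_near (ε := (1 / 64) ^ k * |f x₀|) hδ hTS hx₀ hfx₀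
    (by positivity) hfT fun x hx y hy hxy =>
      ⟨hdec x (hbd x hx y hy hxy).1, hdec y (hbd x hx y hy hxy).2⟩
  refine ⟨μ, hμ, ?_⟩
  rw [hcard, Nat.cast_pow, ← mul_pow, ← mul_pow, sq_le_sq, abs_mul,
    abs_of_nonneg (a := (N : ℝ) * _) (by positivity)] at hle
  have h1 : |lam - μ| * |f x₀| ≤ (N * (1 / 64) ^ k / 128) * |f x₀| := by
    refine hle.trans ?_
    have : 0 ≤ N * (1 / 64 : ℝ) ^ k * |f x₀| := by positivity
    nlinarith
  exact le_of_mul_le_mul_right h1 hpos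

/-- An eigenfunction attains its maximum modulus on the resonant parabola. -/
lemma IsEigen.exists_max_on_parabola {δ μ : ℝ} {S : Finset (ℤ × ℤ)} (hδ : 0 < δ)
    (hδ' : δ < 1 / 512) (hμ : |μ| ≤ 1 / 2) (h : IsEigen δ S μ) :
    ∃ (f : ℤ × ℤ → ℝ) (x₀ : ℤ × ℤ), x₀ ∈ S ∧ pot x₀ = 0 ∧ f x₀ ≠ 0 ∧
      (∀ x, |f x| ≤ |f x₀|) ∧ (∀ x ∈ S, pot x * f x + δ * diagSum f x = μ * f x) ∧
      ∀ x, f x = 0 ∨ pot x * f x + δ * diagSum f x = μ * f x := by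
  obtain ⟨f, hf0, ⟨x₁, hx₁, hfx₁⟩, hf⟩ := h.exists_extension
  obtain ⟨x₀, hx₀, hmax⟩ := S.exists_max_image (fun x => |f x|) ⟨x₁, hx₁⟩
  have hpos : 0 < |f x₀| := (abs_pos.mpr hfx₁).trans_le (hmax x₁ hx₁)
  have hM : ∀ x, |f x| ≤ |f x₀| := by
    intro x
    by_cases hx : x ∈ S
    · exact hmax x hx
    · rw [hf0 x hx, abs_zero]; exact hpos.le
  have hor : ∀ x, f x = 0 ∨ pot x * f x + δ * diagSum f x = μ * f x := fun x => by
    by_cases hx : x ∈ S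
    · exact Or.inr (hf x hx)
    · exact Or.inl (hf0 x hx)
  refine ⟨f, x₀, hx₀, ?_, abs_pos.mp hpos, hM, hf, hor⟩
  by_contra hp
  have := abs_le_of_pot_ne_zero hδ hμ hp hpos.le (hor x₀) fun y _ => hM y
  nlinarith

lemma mem_bigSq {m : ℤ} {x : ℤ × ℤ} :
    x ∈ bigSq m ↔ (-m ≤ x.1 ∧ x.1 ≤ m) ∧ (-m ≤ x.2 ∧ x.2 ≤ m) := by
  simp [bigSq]

lemma mem_sqΛ {j n L : ℤ} {x : ℤ × ℤ} :
    x ∈ sqΛ j n L ↔ (j - L ≤ x.1 ∧ x.1 ≤ j + L) ∧ (n - L ≤ x.2 ∧ x.2 ≤ n + L) := by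
  simp [sqΛ]

/-- Points near the boundary of the square of radius `|j|` around `(j, -j²)` are far from the
resonant parabola. -/
lemma farFromParabola_of_boundary {j : ℤ} {k : ℕ} (hk : (k : ℤ) + 2 = |j|) {x : ℤ × ℤ}
    (h1 : |x.1 - j| ≤ |j| + 1) (h2 : |x.2 + j ^ 2| ≤ |j| + 1)
    (h3 : |j| ≤ |x.1 - j| ∨ |j| ≤ |x.2 + j ^ 2|) : FarFromParabola k x := by
  intro i
  by_contra! hcon
  obtain ⟨c1, c2⟩ := hcon
  have hsq : |i ^ 2 - j ^ 2| ≤ 2 * |j| - 2 := by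
    have : i ^ 2 - j ^ 2 = (x.2 + i ^ 2) - (x.2 + j ^ 2) := by ring
    rw [this]
    have := abs_sub (x.2 + i ^ 2) (x.2 + j ^ 2)
    omega
  have habs : |i| = |j| := by
    rw [← sq_abs i, ← sq_abs j] at hsq
    have hi := abs_nonneg i
    have hj := abs_nonneg j
    rw [abs_le] at hsq
    rcases lt_trichotomy |i| |j| with h | h | h
    · nlinarith
    · exact h
    · nlinarith
  have hij : i ^ 2 = j ^ 2 := by rw [← sq_abs i, ← sq_abs j, habs]
  rw [hij] at c2
  rcases abs_eq_abs.mp habs with rfl | rfl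
  · omega
  · generalize j ^ 2 = s at *
    grind

lemma adj_boundary {j : ℤ} {x y : ℤ × ℤ} (hx : x ∈ sqΛ j (-j ^ 2) |j|)
    (hy : y ∉ sqΛ j (-j ^ 2) |j|) (hxy : DiagAdj x y) {k : ℕ} (hk : (k : ℤ) + 2 = |j|) :
    FarFromParabola k x ∧ FarFromParabola k y := by
  rw [mem_sqΛ] at hx hy
  obtain ⟨a1, a2⟩ := hxy
  constructor <;> refine farFromParabola_of_boundary hk ?_ ?_ ?_ <;>
    generalize j ^ 2 = s at * <;> grind

lemma adj_boundary_strip {x y : ℤ × ℤ}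
    (hx : (-99 ≤ x.1 ∧ x.1 ≤ 99) ∧ (-90 ≤ x.2 ∧ x.2 ≤ 99))
    (hy : ¬((-99 ≤ y.1 ∧ y.1 ≤ 99) ∧ (-90 ≤ y.2 ∧ y.2 ≤ 99))) (hxy : DiagAdj x y) :
    FarFromParabola 8 x ∧ FarFromParabola 8 y := by
  have key : ∀ z : ℤ × ℤ, |z.1| ≤ 100 → -91 ≤ z.2 → z.2 ≤ 100 →
      (99 ≤ |z.1| ∨ 99 ≤ z.2 ∨ z.2 ≤ -90) → FarFromParabola 8 z := by
    intro z h1 h2 h3 h4 j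
    by_contra! hcon
    obtain ⟨c1, c2⟩ := hcon
    push_cast at c1 c2
    rw [← sq_abs j, abs_lt] at c2
    have hj := abs_nonneg j
    have hlt : |j| < 10 := by nlinarith
    rcases h4 with h4 | h4 | h4
    · grind
    · nlinarith
    · have : |j| ≤ 9 := by omega
      nlinarith
  obtain ⟨a1, a2⟩ := hxy
  constructor <;> refine key _ ?_ ?_ ?_ ?_ <;> grind

/-- Eigenvalues of `H_{Λ_j}` of modulus at most `1/2` lie in `[-2δ, 2δ]`. -/
lemma IsEigen.mem_Icc_of_sqΛ {δ μ : ℝ} {j : ℤ} (hδ : 0 < δ) (hδ' : δ < 1 / 512)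
    (hμ : |μ| ≤ 1 / 2) (hj : 10 ≤ |j|) (h : IsEigen δ (sqΛ j (-j ^ 2) |j|) μ) :
    μ ∈ Set.Icc (-(2 * δ)) (2 * δ) := by
  obtain ⟨f, ⟨a, b⟩, hmem, hp, hne, hM, hf, hor⟩ := h.exists_max_on_parabola hδ hδ' hμ
  have hpos : 0 < |f (a, b)| := abs_pos.mpr hne
  have hb : b = -a ^ 2 := by simp only [pot] at hp; omega
  have ha : 2 ≤ |a| := by
    rw [mem_sqΛ] at hmem
    simp only at hmem
    rw [hb, ← sq_abs a, ← sq_abs j] at hmem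
    have := abs_nonneg a
    nlinarith
  have hnb : ∀ y, DiagAdj (a, b) y → |f y| ≤ 8 * δ * |f (a, b)| := by
    intro y hy
    refine abs_le_of_pot_ne_zero hδ hμ ?_ hpos.le (hor y) fun z _ => hM z
    obtain ⟨c, d⟩ := y
    simp only [DiagAdj, abs_eq (zero_le_one (α := ℤ))] at hy
    obtain ⟨h1, h2⟩ := hy
    have hd : d = -a ^ 2 - 1 ∨ d = -a ^ 2 + 1 := by omega
    have hc : c = a - 1 ∨ c = a + 1 := by omega
    rw [le_abs] at ha
    simp only [pot]
    rcases hc with rfl | rfl <;> rcases hd with rfl | rfl <;> ring_nf <;> omega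
  have h1 := abs_diagSum_le hnb
  have h2 := hf _ hmem
  rw [hp, Int.cast_zero, zero_mul, zero_add] at h2
  have h3 : |μ| * |f (a, b)| ≤ 2 * δ * |f (a, b)| := by
    rw [← abs_mul, ← h2, abs_mul, abs_of_pos hδ]
    calc δ * |diagSum f (a, b)| ≤ δ * (4 * (8 * δ * |f (a, b)|)) := by gcongr
      _ = 32 * δ * (δ * |f (a, b)|) := by ring
      _ ≤ 2 * (δ * |f (a, b)|) := by gcongr; linarith
      _ = _ := by ring
  exact abs_le.mp (le_of_mul_le_mul_right h3 hpos)

lemma exp_neg_natCast_ge (m : ℕ) : (1 / 4 : ℝ) ^ m ≤ Real.exp (-m) := by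
  rw [← mul_neg_one, Real.exp_nat_mul]
  gcongr
  rw [Real.exp_neg, one_div]
  gcongr
  linarith [Real.exp_one_lt_d9]

lemma box_bound (k : ℕ) :
    ((2 * (k + 2) + 1 : ℕ) : ℝ) * (1 / 64) ^ k / 128 ≤ Real.exp (-(k + 2 : ℕ)) := by
  refine le_trans ?_ (exp_neg_natCast_ge (k + 2))
  have h : ((2 * (k + 2) + 1 : ℕ) : ℝ) ≤ 8 * 16 ^ k := by
    induction k with
    | zero => norm_num
    | succ k ih =>
      push_cast at *
      rw [pow_succ]
      nlinarith [one_le_pow₀ (n := k) (by norm_num : (1 : ℝ) ≤ 16)]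
  calc _ ≤ (8 * 16 ^ k : ℝ) * (1 / 64) ^ k / 128 := by gcongr
    _ = 8 * (16 * (1 / 64)) ^ k / 128 := by rw [mul_pow]; ring
    _ = (1 / 4) ^ (k + 2) := by rw [pow_add]; norm_num; ring

/-- every eigenvalue of `H_Λ`, `Λ = ([−L²+1, L²−1] ∩ ℤ)²`, lying in
`[−2δ, 2δ]` is exponentially close either to an eigenvalue of `H_{Λ₀}` or to the
eigenvalue of some `H_{Λ_j}` in `[−2δ, 2δ]` with `L₀ ≤ |j| < L`. -/
theorem eigenvalues_come_from_local_boxes :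
    ∃ δ₀ > (0 : ℝ), ∀ δ : ℝ, 0 < δ → δ < δ₀ →
      ∃ α : ℝ, ∃ L₀ : ℤ, 0 < α ∧ 0 < L₀ ∧
        ∀ L : ℤ, L₀ < L →
          ∀ lam : ℝ, IsEigen δ (bigSq (L ^ 2 - 1)) lam →
            lam ∈ Set.Icc (-(2 * δ)) (2 * δ) →
            ((∃ μ : ℝ, IsEigen δ (bigSq (L₀ ^ 2 - 1)) μ ∧
                |lam - μ| ≤ Real.exp (-α * (L₀ : ℝ))) ∨
             (∃ j n Lj : ℤ, n + j ^ 2 = 0 ∧ L₀ ≤ |j| ∧ |j| < L ∧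
                |j| ≤ Lj ∧ Lj ≤ 2 * (|j| - 1) ∧
                ∃ lamj : ℝ, IsEigen δ (sqΛ j n Lj) lamj ∧
                  lamj ∈ Set.Icc (-(2 * δ)) (2 * δ) ∧
                  |lam - lamj| ≤ Real.exp (-α * |(j : ℝ)|))) := by
  refine ⟨1 / 512, by norm_num, fun δ hδ hδ' => ⟨1, 10, one_pos, by norm_num, ?_⟩⟩
  intro L hL lam hlam hmem
  have habs : |lam| ≤ 2 * δ := abs_le.mpr hmem
  obtain ⟨f, ⟨j, n⟩, hx₀, hp, hne, hM, hf, hor⟩ :=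
    hlam.exists_max_on_parabola hδ hδ' (by linarith)
  have hn : n = -j ^ 2 := by simp only [pot] at hp; omega
  subst hn
  rw [mem_bigSq] at hx₀
  simp only at hx₀
  have hjL : |j| < L := by
    rw [← sq_abs j] at hx₀
    have := abs_nonneg j
    nlinarith
  rcases lt_or_ge |j| 10 with hj | hj
  · left
    obtain ⟨T, hT⟩ : ∃ T : Finset (ℤ × ℤ), ∀ x,
        x ∈ T ↔ (-99 ≤ x.1 ∧ x.1 ≤ 99) ∧ (-90 ≤ x.2 ∧ x.2 ≤ 99) :=
      ⟨Finset.Icc (-99) 99 ×ˢ Finset.Icc (-90) 99, by simp⟩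
    have hsub : ∀ x ∈ T, x ∈ bigSq (L ^ 2 - 1) := by
      intro x hx
      rw [hT] at hx
      rw [mem_bigSq]
      have : 121 ≤ L ^ 2 := by nlinarith
      omega
    obtain ⟨μ, hμ, hle⟩ := exists_isEigen_near_of_farFromParabola (S := bigSq (10 ^ 2 - 1))
      (T := T) (k := 8) (N := 199) hδ hδ'
      (by linarith) (fun x hx => by
        rw [hT] at hx
        rw [mem_bigSq]; omega)
      (by
        rw [abs_lt] at hj
        rw [hT]
        refine ⟨by omega, ?_, ?_⟩ <;> nlinarith) hne hM hor (fun x hx => hf x (hsub x hx))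
      (fun x hx y hy hxy => adj_boundary_strip ((hT x).mp hx)
        (fun h => hy ((hT y).mpr h)) hxy) (by
        simp only [bigSq, Finset.card_product, Int.card_Icc]; rfl)
    refine ⟨μ, hμ, hle.trans ?_⟩
    have := exp_neg_natCast_ge 10
    norm_num at this ⊢
    linarith
  · right
    obtain ⟨k, hk⟩ : ∃ k : ℕ, (k : ℤ) + 2 = |j| := ⟨(|j| - 2).toNat, by omega⟩
    have hsub : ∀ x ∈ sqΛ j (-j ^ 2) |j|, x ∈ bigSq (L ^ 2 - 1) := by
      intro x hx
      rw [mem_sqΛ] at hx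
      rw [mem_bigSq]
      have h1 := neg_abs_le j
      have h2 := le_abs_self j
      have h3 := sq_abs j
      rw [← h3] at hx
      refine ⟨⟨?_, ?_⟩, ?_, ?_⟩ <;> nlinarith
    obtain ⟨μ, hμ, hle⟩ := exists_isEigen_near_of_farFromParabola (S := sqΛ j (-j ^ 2) |j|)
      (T := sqΛ j (-j ^ 2) |j|) (k := k) (N := 2 * (k + 2) + 1) hδ hδ' (by linarith)
      subset_rfl (by rw [mem_sqΛ]; simp only; have := neg_abs_le j; omega) hne hM hor
      (fun x hx => hf x (hsub x hx)) (fun x hx y hy hxy => adj_boundary hx hy hxy hk) (by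
        simp only [sqΛ, Finset.card_product, Int.card_Icc, sq]
        congr 1 <;> omega)
    have hle' := hle.trans (box_bound k)
    have hkj : ((k + 2 : ℕ) : ℝ) = |(j : ℝ)| := by
      rw [← Int.cast_abs, ← hk]; push_cast; ring
    refine ⟨j, -j ^ 2, |j|, by ring, hj, hjL, le_rfl, by omega, μ, hμ, ?_, ?_⟩
    · refine hμ.mem_Icc_of_sqΛ hδ hδ' ?_ hj
      have h1 : Real.exp (-(k + 2 : ℕ)) ≤ 3 / 8 := by
        have h2 : Real.exp (-(k + 2 : ℕ)) ≤ Real.exp (-1) := by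
          gcongr; push_cast; linarith [(Nat.cast_nonneg k : (0 : ℝ) ≤ k)]
        linarith [Real.exp_neg_one_lt_d9]
      have := abs_sub_abs_le_abs_sub μ lam
      rw [abs_sub_comm] at this
      linarith
    · rwa [neg_one_mul, ← hkj]
end
end

section
/- There exist δ₀ > 0 and, for each δ with 0 < δ < δ₀, constants C < ∞ and κ > 0 such that for every finite set B ⊆ ℤ×ℤ with B ∩ P = ∅ and every E ∈ [−2δ, 2δ], the matrix H_B − E·Id is invertible and its inverse has exponentially decaying entries: |((H_B − E·Id)^{−1})(x,y)| ≤ C·e^{−κ|x−y|₁} for all x, y ∈ B. -/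
noncomputable section

/-- The ℓ¹ distance on `ℤ × ℤ`. -/
def dist1 (x y : ℤ × ℤ) : ℤ := |x.1 - y.1| + |x.2 - y.2|

open Finset in
/-- Weighted diagonal dominance bounds the entries of a right inverse. -/
theorem weighted_entry_bound_of_mul_eq_one {n : Type*} [Fintype n] [DecidableEq n]
    {A G : Matrix n n ℝ} (hAG : A * G = 1) {a : ℝ} {w : n → ℝ} (hw : ∀ x, 0 < w x)
    (hdom : ∀ x, a + ∑ z ∈ univ.erase x, |A x z| * (w x / w z) ≤ |A x x|)
    (ha : 0 < a) (x y : n) : a * (w x * |G x y|) ≤ w y := by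
  have : Nonempty n := ⟨x⟩
  obtain ⟨m, hm⟩ := Finite.exists_max fun z => w z * |G z y|
  have hrow : A m m * G m y = (1 : Matrix n n ℝ) m y - ∑ z ∈ univ.erase m, A m z * G z y := by
    rw [← hAG, Matrix.mul_apply, ← add_sum_erase _ _ (mem_univ m)]
    ring
  have hone : w m * |(1 : Matrix n n ℝ) m y| ≤ w y := by
    by_cases h : m = y
    · subst h; simp
    · simpa [Matrix.one_apply_ne h] using (hw y).le
  have hsum : w m * |∑ z ∈ univ.erase m, A m z * G z y| ≤
      (∑ z ∈ univ.erase m, |A m z| * (w m / w z)) * (w m * |G m y|) := by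
    rw [sum_mul]
    refine (mul_le_mul_of_nonneg_left (abs_sum_le_sum_abs _ _) (hw m).le).trans ?_
    rw [mul_sum]
    refine sum_le_sum fun z _ => ?_
    have hz := (hw z).ne'
    calc w m * |A m z * G z y| = |A m z| * (w m / w z) * (w z * |G z y|) := by
          rw [abs_mul]; field_simp
      _ ≤ _ := mul_le_mul_of_nonneg_left (hm z)
          (mul_nonneg (abs_nonneg _) (div_pos (hw m) (hw z)).le)
  have hmul : |A m m| * (w m * |G m y|) ≤
      w y + (∑ z ∈ univ.erase m, |A m z| * (w m / w z)) * (w m * |G m y|) := by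
    calc |A m m| * (w m * |G m y|) = w m * |A m m * G m y| := by rw [abs_mul]; ring
      _ ≤ w m * (|(1 : Matrix n n ℝ) m y| + |∑ z ∈ univ.erase m, A m z * G z y|) := by
          rw [hrow]; exact mul_le_mul_of_nonneg_left (abs_sub _ _) (hw m).le
      _ ≤ _ := by rw [mul_add]; exact add_le_add hone hsum
  have hmax := mul_le_mul_of_nonneg_right (hdom m) (mul_nonneg (hw m).le (abs_nonneg (G m y)))
  have := mul_le_mul_of_nonneg_left (hm x) ha.le
  linarith

/-- Each site has at most four neighbours, so a row sum of off-diagonal entries, weighted by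
numbers that are at most `c` at the neighbours, is at most `4 * δ * c`. -/
theorem sum_offdiag_Hmat_le {δ c : ℝ} (hδ : 0 ≤ δ) (hc : 0 ≤ c) (B : Finset (ℤ × ℤ)) (x : B)
    (u : B → ℝ) (hu : ∀ z : B, |x.1.1 - z.1.1| = 1 → |x.1.2 - z.1.2| = 1 → u z ≤ c) :
    ∑ z ∈ Finset.univ.erase x, |Hmat δ B x z| * u z ≤ 4 * δ * c := by
  set N : Finset (ℤ × ℤ) := {(x.1.1 + 1, x.1.2 + 1), (x.1.1 + 1, x.1.2 - 1),
    (x.1.1 - 1, x.1.2 + 1), (x.1.1 - 1, x.1.2 - 1)} with hN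
  have hterm : ∀ z ∈ Finset.univ.erase x,
      |Hmat δ B x z| * u z ≤ if z.1 ∈ N then δ * c else 0 := by
    intro z hz
    have hne : (x : ℤ × ℤ) ≠ z := fun h => Finset.ne_of_mem_erase hz (Subtype.ext h.symm)
    by_cases h : |x.1.1 - z.1.1| = 1 ∧ |x.1.2 - z.1.2| = 1
    · have hmem : z.1 ∈ N := by
        simp only [hN, Finset.mem_insert, Finset.mem_singleton, Prod.ext_iff]
        rcases abs_eq (zero_le_one) |>.1 h.1 with h1 | h1 <;>
          rcases abs_eq (zero_le_one) |>.1 h.2 with h2 | h2 <;> omega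
      simp only [Hmat, if_neg hne, if_pos h, if_pos hmem, abs_of_nonneg hδ]
      exact mul_le_mul_of_nonneg_left (hu z h.1 h.2) hδ
    · simp only [Hmat, if_neg hne, if_neg h, abs_zero, zero_mul]
      split_ifs <;> positivity
  have hcard : ((Finset.univ.erase x).filter fun z : B => z.1 ∈ N).card ≤ 4 :=
    (Finset.card_le_card_of_injOn Subtype.val (fun z hz => (Finset.mem_filter.1 hz).2)
      Subtype.val_injective.injOn).trans Finset.card_le_four
  calc ∑ z ∈ Finset.univ.erase x, |Hmat δ B x z| * u z
      ≤ ∑ z ∈ Finset.univ.erase x, if z.1 ∈ N then δ * c else 0 := Finset.sum_le_sum hterm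
    _ = ((Finset.univ.erase x).filter fun z : B => z.1 ∈ N).card * (δ * c) := by
        rw [← Finset.sum_filter, Finset.sum_const, nsmul_eq_mul]
    _ ≤ 4 * (δ * c) := by gcongr; exact_mod_cast hcard
    _ = 4 * δ * c := by ring

/-- A site off the parabola has diagonal entry at distance at least `1 - |E|` from `E`. -/
theorem one_sub_le_abs_diag {δ E : ℝ} {B : Finset (ℤ × ℤ)}
    (hB : ∀ p ∈ B, p.2 + p.1 ^ 2 ≠ 0) (x : B) :
    1 - |E| ≤ |(Hmat δ B - E • (1 : Matrix B B ℝ)) x x| := by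
  have hint : (1 : ℝ) ≤ |((x.1.2 + x.1.1 ^ 2 : ℤ) : ℝ)| := by
    exact_mod_cast Int.one_le_abs (hB x x.2)
  have hentry : (Hmat δ B - E • (1 : Matrix B B ℝ)) x x =
      ((x.1.2 + x.1.1 ^ 2 : ℤ) : ℝ) - E := by
    simp [Hmat]
  rw [hentry]
  linarith [abs_sub_abs_le_abs_sub ((x.1.2 + x.1.1 ^ 2 : ℤ) : ℝ) E]

/-- Neighbouring sites have distances to a third site that differ by at most `2`. -/
theorem dist1_le_dist1_add_two {x y z : ℤ × ℤ} (h1 : |x.1 - z.1| = 1) (h2 : |x.2 - z.2| = 1) :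
    dist1 x y ≤ dist1 z y + 2 := by
  have := abs_sub_le x.1 z.1 y.1
  have := abs_sub_le x.2 z.2 y.2
  simp only [dist1]
  omega

/-- off the resonant parabola, the resolvent `(H_B − E)⁻¹` exists for
`E ∈ [−2δ, 2δ]` and has exponentially decaying matrix entries. -/
theorem offdiagonal_resolvent_decay :
    ∃ δ₀ > (0 : ℝ), ∀ δ : ℝ, 0 < δ → δ < δ₀ →
      ∃ (C : ℝ) (κ : ℝ), 0 < κ ∧
        ∀ B : Finset (ℤ × ℤ), (∀ p ∈ B, p.2 + p.1 ^ 2 ≠ 0) →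
          ∀ E ∈ Set.Icc (-(2 * δ)) (2 * δ),
            IsUnit (Hmat δ B - E • (1 : Matrix B B ℝ)) ∧
            ∀ x y : B,
              |(Hmat δ B - E • (1 : Matrix B B ℝ))⁻¹ x y| ≤
                C * Real.exp (-κ * ((dist1 (x : ℤ × ℤ) (y : ℤ × ℤ) : ℤ) : ℝ)) := by
  refine ⟨1 / 20, by norm_num, fun δ hδ hδ' => ⟨2, Real.log 2 / 2, by positivity, ?_⟩⟩
  intro B hB E hE
  set A := Hmat δ B - E • (1 : Matrix B B ℝ) with hA
  have hEabs : |E| ≤ 2 * δ := abs_le.2 hE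
  have hdiag (x : B) : 1 - |E| ≤ |A x x| := one_sub_le_abs_diag hB x
  have hoff (x : B) (u : B → ℝ) : ∑ z ∈ Finset.univ.erase x, |A x z| * u z =
      ∑ z ∈ Finset.univ.erase x, |Hmat δ B x z| * u z :=
    Finset.sum_congr rfl fun z hz => by
      simp [hA, Matrix.one_apply_ne (Finset.ne_of_mem_erase hz).symm]
  have hdet : A.det ≠ 0 := by
    refine det_ne_zero_of_sum_row_lt_diag fun x => ?_
    have hsum := sum_offdiag_Hmat_le hδ.le zero_le_one B x (fun _ => 1) fun _ _ _ => le_rfl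
    rw [← hoff] at hsum
    simp only [mul_one] at hsum
    simp only [Real.norm_eq_abs]
    linarith [hdiag x]
  have hunit : IsUnit A.det := isUnit_iff_ne_zero.2 hdet
  refine ⟨(Matrix.isUnit_iff_isUnit_det A).2 hunit, fun x y => ?_⟩
  have hdom (x : B) : 1 / 2 + ∑ z ∈ Finset.univ.erase x, |A x z| *
      (Real.exp (Real.log 2 / 2 * (dist1 x y : ℝ)) /
        Real.exp (Real.log 2 / 2 * (dist1 z y : ℝ))) ≤ |A x x| := by
    have hsum := sum_offdiag_Hmat_le hδ.le zero_le_two B x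
      (fun z => Real.exp (Real.log 2 / 2 * (dist1 x y : ℝ)) /
        Real.exp (Real.log 2 / 2 * (dist1 z y : ℝ))) fun z h1 h2 => by
          have hd : (dist1 x y : ℝ) ≤ dist1 z y + 2 := by
            exact_mod_cast dist1_le_dist1_add_two h1 h2
          rw [← Real.exp_sub, ← Real.le_log_iff_exp_le two_pos]
          nlinarith [Real.log_pos one_lt_two]
    rw [hoff]
    linarith [hdiag x]
  have hbound := weighted_entry_bound_of_mul_eq_one (Matrix.mul_nonsing_inv A hunit)
    (w := fun z : B => Real.exp (Real.log 2 / 2 * (dist1 z y : ℝ)))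
    (fun _ => Real.exp_pos _) hdom (by norm_num) x y
  have hself : dist1 (y : ℤ × ℤ) y = 0 := by simp [dist1]
  simp only [hself, Int.cast_zero, mul_zero, Real.exp_zero] at hbound
  rw [neg_mul, Real.exp_neg, ← div_eq_mul_inv, le_div_iff₀ (Real.exp_pos _)]
  linarith
end
end

section
/- There exists δ₀ > 0 such that for every δ with 0 < δ < δ₀ and every integer L ≥ 8, the number 0 is not an eigenvalue of the real symmetric matrix H_Λ for Λ = ([−L, L] ∩ ℤ)². -/
noncomputable section

/-- `u : ℤ × ℤ → ℝ`, written in curried form, vanishes off the square `[-L, L]²` and is annihilated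
there by the Hamiltonian with hopping amplitude `δ`. -/
structure IsNullVector (δ : ℝ) (L : ℤ) (u : ℤ → ℤ → ℝ) : Prop where
  eq_zero : ∀ j n : ℤ, ¬ (|j| ≤ L ∧ |n| ≤ L) → u j n = 0
  eqn : ∀ j n : ℤ, |j| ≤ L → |n| ≤ L →
    ((n + j ^ 2 : ℤ) : ℝ) * u j n =
      -δ * (u (j + 1) (n + 1) + u (j + 1) (n - 1) + u (j - 1) (n + 1) + u (j - 1) (n - 1))

/-- Extension by zero of a vector on `[-L, L]²`. -/
def extendZero (L : ℤ) (v : ↥(Finset.Icc (-L) L ×ˢ Finset.Icc (-L) L) → ℝ) (j n : ℤ) : ℝ :=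
  if h : (j, n) ∈ Finset.Icc (-L) L ×ˢ Finset.Icc (-L) L then v ⟨(j, n), h⟩ else 0

theorem mem_square_iff {L j n : ℤ} :
    (j, n) ∈ Finset.Icc (-L) L ×ˢ Finset.Icc (-L) L ↔ |j| ≤ L ∧ |n| ≤ L := by
  simp [abs_le]

theorem isNullVector_extendZero {δ : ℝ} {L : ℤ}
    {v : ↥(Finset.Icc (-L) L ×ˢ Finset.Icc (-L) L) → ℝ}
    (hv : (Hmat δ (Finset.Icc (-L) L ×ˢ Finset.Icc (-L) L)).mulVec v = 0) :
    IsNullVector δ L (extendZero L v) := by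
  refine ⟨fun j n h => dif_neg (mt mem_square_iff.1 h), fun j n hj hn => ?_⟩
  have hmem := mem_square_iff.2 ⟨hj, hn⟩
  have key := congrFun hv ⟨(j, n), hmem⟩
  let S := Finset.Icc (-L) L ×ˢ Finset.Icc (-L) L
  let c : ℤ × ℤ → ℝ := fun y =>
    if (j, n) = y then ((n + j ^ 2 : ℤ) : ℝ)
    else if |j - y.1| = 1 ∧ |n - y.2| = 1 then δ else 0
  have hsum : ∑ y ∈ S, c y * extendZero L v y.1 y.2 = 0 := by
    rw [← Finset.sum_coe_sort]
    refine (Finset.sum_congr rfl fun y _ => ?_).trans key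
    have : extendZero L v (y : ℤ × ℤ).1 (y : ℤ × ℤ).2 = v y := dif_pos y.2
    rw [this]
    rfl
  have hT : ∑ y ∈ S, c y * extendZero L v y.1 y.2 =
      ∑ y ∈ ({(j, n), (j + 1, n + 1), (j + 1, n - 1), (j - 1, n + 1), (j - 1, n - 1)} :
        Finset (ℤ × ℤ)), c y * extendZero L v y.1 y.2 := by
    refine Finset.sum_congr_of_eq_on_inter ?_ ?_ fun _ _ _ => rfl
    · rintro ⟨a, b⟩ - hy
      simp only [Finset.mem_insert, Finset.mem_singleton, Prod.mk.injEq] at hy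
      have h1 : ¬ (j, n) = (a, b) := by
        simp only [Prod.mk.injEq]; omega
      have h2 : ¬ (|j - a| = 1 ∧ |n - b| = 1) := by
        simp only [abs_eq (zero_le_one' ℤ)]; omega
      simp [c, h1, h2]
    · rintro ⟨a, b⟩ - hy
      have : extendZero L v a b = 0 := dif_neg hy
      simp [this]
  rw [hT, Finset.sum_insert, Finset.sum_insert, Finset.sum_insert, Finset.sum_insert,
    Finset.sum_singleton] at hsum
  · simp only [c] at hsum
    have hne : ¬ j = j - 1 := by omega
    simp [hne] at hsum
    push_cast
    linarith
  all_goals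
    simp only [Finset.mem_insert, Finset.mem_singleton, Prod.mk.injEq]
    omega

/-- Elimination of the four neighbours of a resonant site: the leading contributions combine into
a nonzero multiple of `x`. -/
theorem abs_le_of_resonant_equations {δ J M x a b s e₁ e₂ e₃ e₄ : ℝ} (hδ : 0 < δ) (hJ : 2 ≤ |J|)
    (ha : (2 * J + 2) * a = -δ * (x + e₁)) (hb : (2 - 2 * J) * b = -δ * (x + e₂))
    (hs : 2 * J * s = -δ * (e₃ - e₄)) (hsum : a + b + s = 0)
    (h₁ : |e₁| ≤ 3 * M) (h₂ : |e₂| ≤ 3 * M) (h₃ : |e₃| ≤ 3 * M) (h₄ : |e₄| ≤ 3 * M) :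
    |x| ≤ 6 * M * (|J| + 1) := by
  have hM : 0 ≤ 3 * M := (abs_nonneg _).trans h₁
  have hx : 2 * J * x = J * (J - 1) * e₁ - J * (J + 1) * e₂ + (J ^ 2 - 1) * (e₃ - e₄) := by
    apply mul_left_cancel₀ hδ.ne'
    linear_combination (-(J * (J - 1))) * ha + (J * (J + 1)) * hb - (J ^ 2 - 1) * hs +
      2 * J * (J ^ 2 - 1) * hsum
  have hm : |J - 1| ≤ |J| + 1 := by simpa using abs_sub J 1
  have hp : |J + 1| ≤ |J| + 1 := by simpa using abs_add_le J 1
  have hsq : |J ^ 2 - 1| ≤ |J| * (|J| + 1) := by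
    rw [abs_of_nonneg] <;> nlinarith [sq_abs J]
  have hd : |e₃ - e₄| ≤ 3 * M + 3 * M := (abs_sub _ _).trans (add_le_add h₃ h₄)
  have hpos : 0 < |J| := by linarith
  have hbound : 2 * |J| * |x| ≤ 2 * |J| * (6 * M * (|J| + 1)) := calc
    2 * |J| * |x| = |2 * J * x| := by simp [abs_mul]
    _ ≤ |J| * |J - 1| * |e₁| + |J| * |J + 1| * |e₂| + |J ^ 2 - 1| * |e₃ - e₄| := by
      rw [hx, ← abs_mul, ← abs_mul, ← abs_mul, ← abs_mul, ← abs_mul]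
      exact (abs_add_le _ _).trans (by gcongr; exact abs_sub _ _)
    _ ≤ |J| * (|J| + 1) * (3 * M) + |J| * (|J| + 1) * (3 * M) +
        |J| * (|J| + 1) * (3 * M + 3 * M) := by gcongr
    _ = 2 * |J| * (6 * M * (|J| + 1)) := by ring
  exact le_of_mul_le_mul_left hbound (by positivity)

theorem abs_add_three_le {M a b c : ℝ} (ha : |a| ≤ M) (hb : |b| ≤ M) (hc : |c| ≤ M) :
    |a + b + c| ≤ 3 * M := by
  linarith [abs_add_three a b c]

section

variable {δ M : ℝ} {L : ℤ} {u : ℤ → ℤ → ℝ}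

/-- Control of a null vector at the resonant sites away from the core `|j| ≤ 1`. -/
theorem IsNullVector.abs_resonant_le_of_two_le (hu : IsNullVector δ L u) (hδ : 0 < δ)
    (hM : ∀ j n : ℤ, n + j ^ 2 ≠ 0 → |u j n| ≤ M) {j : ℤ} (hj : 2 ≤ |j|) (hjL : j ^ 2 ≤ L) :
    |u j (-j ^ 2)| ≤ 6 * M * (|(j : ℝ)| + 1) := by
  have hj' : j ≤ -2 ∨ 2 ≤ j := by rcases le_abs'.1 hj with h | h <;> omega
  have hb : |j| + 1 ≤ L := by nlinarith [sq_abs j]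
  have hbd := abs_le.1 (show |j| ≤ L - 1 by omega)
  have hsq : 4 ≤ j ^ 2 := by nlinarith [sq_abs j]
  have hM0 : 0 ≤ M := (abs_nonneg _).trans (hM 0 1 (by norm_num))
  have e0 := hu.eqn j (-j ^ 2) (by omega) (abs_le.2 (by omega))
  have e1 := hu.eqn (j + 1) (-j ^ 2 + 1) (abs_le.2 (by omega)) (abs_le.2 (by omega))
  have e2 := hu.eqn (j - 1) (-j ^ 2 + 1) (abs_le.2 (by omega)) (abs_le.2 (by omega))
  simp only [add_sub_cancel_right, sub_add_cancel] at e0 e1 e2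
  have hnear : ∀ a b : ℤ, b + 2 * j * a + a ^ 2 ≠ 0 → |u (j + a) (-j ^ 2 + b)| ≤ M := by
    intro a b h
    refine hM _ _ fun h0 => h ?_
    linear_combination h0
  have hlow : ∃ e₃ e₄ : ℝ, |e₃| ≤ 3 * M ∧ |e₄| ≤ 3 * M ∧
      2 * (j : ℝ) * (u (j + 1) (-j ^ 2 - 1) + u (j - 1) (-j ^ 2 - 1)) = -δ * (e₃ - e₄) := by
    by_cases hL : j ^ 2 + 1 ≤ L
    · have e3 := hu.eqn (j + 1) (-j ^ 2 - 1) (abs_le.2 (by omega)) (abs_le.2 (by omega))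
      have e4 := hu.eqn (j - 1) (-j ^ 2 - 1) (abs_le.2 (by omega)) (abs_le.2 (by omega))
      simp only [add_sub_cancel_right, sub_add_cancel] at e3 e4
      refine ⟨_, _,
        abs_add_three_le (hnear 2 0 (by omega)) (hnear 2 (-2) (by omega)) (hnear 0 (-2) (by omega)),
        abs_add_three_le (hnear 0 (-2) (by omega)) (hnear (-2) 0 (by omega))
          (hnear (-2) (-2) (by omega)), ?_⟩
      simp only [add_assoc, sub_eq_add_neg, add_zero, one_add_one_eq_two] at e3 e4 ⊢
      norm_num at e3 e4 ⊢
      linear_combination e3 - e4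
    · refine ⟨0, 0, by simpa using hM0, by simpa using hM0, ?_⟩
      have hout : ∀ i, u i (-j ^ 2 - 1) = 0 := fun i =>
        hu.eq_zero _ _ fun h => hL (by have := (abs_le.1 h.2).1; omega)
      simp [hout]
  obtain ⟨e₃, e₄, h₃, h₄, hs⟩ := hlow
  refine abs_le_of_resonant_equations (J := j) (a := u (j + 1) (-j ^ 2 + 1))
    (b := u (j - 1) (-j ^ 2 + 1)) hδ (by exact_mod_cast hj) ?_ ?_ hs ?_
    (abs_add_three_le (hnear 2 2 (by omega)) (hnear 2 0 (by omega)) (hnear 0 2 (by omega)))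
    (abs_add_three_le (hnear 0 2 (by omega)) (hnear (-2) 2 (by omega)) (hnear (-2) 0 (by omega)))
    h₃ h₄
  · simp only [add_assoc, add_zero, one_add_one_eq_two] at e1 ⊢
    norm_num at e1 ⊢
    linear_combination e1
  · simp only [add_assoc, sub_eq_add_neg, add_zero, one_add_one_eq_two] at e2 ⊢
    norm_num at e2 ⊢
    linear_combination e2
  · rw [neg_add_cancel, Int.cast_zero, zero_mul] at e0
    have := (mul_eq_zero.1 e0.symm).resolve_left (neg_ne_zero.2 hδ.ne')
    linear_combination this

/-- Control of a null vector at the three coupled resonant sites `(0, 0)` and `(±1, -1)`. -/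
theorem IsNullVector.abs_core_le (hu : IsNullVector δ L u) (hδ : 0 < δ) (hL : 2 ≤ L)
    (hM : ∀ j n : ℤ, n + j ^ 2 ≠ 0 → |u j n| ≤ M) :
    |u 0 0| ≤ 3 * M ∧ |u 1 (-1)| ≤ 4 * M ∧ |u (-1) (-1)| ≤ 4 * M := by
  have e0 := hu.eqn 0 0 (abs_le.2 (by omega)) (abs_le.2 (by omega))
  have e1 := hu.eqn 1 (-1) (abs_le.2 (by omega)) (abs_le.2 (by omega))
  have e2 := hu.eqn (-1) (-1) (abs_le.2 (by omega)) (abs_le.2 (by omega))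
  have e3 := hu.eqn 2 0 (abs_le.2 (by omega)) (abs_le.2 (by omega))
  have e4 := hu.eqn 2 (-2) (abs_le.2 (by omega)) (abs_le.2 (by omega))
  have e5 := hu.eqn (-2) 0 (abs_le.2 (by omega)) (abs_le.2 (by omega))
  have e6 := hu.eqn (-2) (-2) (abs_le.2 (by omega)) (abs_le.2 (by omega))
  norm_num [hδ.ne'] at e0 e1 e2 e3 e4 e5 e6
  have f1 := abs_le.1 (hM 1 1 (by norm_num))
  have f2 := abs_le.1 (hM (-1) 1 (by norm_num))
  have g1 := abs_le.1 (hM 2 0 (by norm_num))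
  have g2 := abs_le.1 (hM 2 (-2) (by norm_num))
  have g3 := abs_le.1 (hM 0 (-2) (by norm_num))
  have p1 := abs_le.1 (hM 3 1 (by norm_num))
  have p2 := abs_le.1 (hM 3 (-1) (by norm_num))
  have p3 := abs_le.1 (hM 3 (-3) (by norm_num))
  have p4 := abs_le.1 (hM 1 (-3) (by norm_num))
  have q1 := abs_le.1 (hM (-3) 1 (by norm_num))
  have q2 := abs_le.1 (hM (-3) (-1) (by norm_num))
  have q3 := abs_le.1 (hM (-3) (-3) (by norm_num))
  have q4 := abs_le.1 (hM (-1) (-3) (by norm_num))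
  have hdiff : 3 * (u 1 (-1) - u (-1) (-1)) =
      -(u 3 1 + u 3 (-1) + u 1 1) - 2 * (u 3 (-1) + u 3 (-3) + u 1 (-3)) +
        (u (-3) 1 + u (-3) (-1) + u (-1) 1) +
        2 * (u (-3) (-1) + u (-3) (-3) + u (-1) (-3)) := by
    apply mul_left_cancel₀ hδ.ne'
    linear_combination e3 - e5 + 2 * (e4 - e6) - 4 * (e1 - e2)
  refine ⟨abs_le.2 ⟨?_, ?_⟩, abs_le.2 ⟨?_, ?_⟩, abs_le.2 ⟨?_, ?_⟩⟩ <;> linarith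

theorem IsNullVector.abs_resonant_le (hu : IsNullVector δ L u) (hδ : 0 < δ) (hL : 2 ≤ L)
    (hM : ∀ j n : ℤ, n + j ^ 2 ≠ 0 → |u j n| ≤ M) (j : ℤ) :
    |u j (-j ^ 2)| ≤ 6 * M * (|(j : ℝ)| + 1) := by
  have hM0 : 0 ≤ M := (abs_nonneg _).trans (hM 0 1 (by norm_num))
  by_cases hjL : j ^ 2 ≤ L
  · by_cases hj : 2 ≤ |j|
    · exact hu.abs_resonant_le_of_two_le hδ hM hj hjL
    · obtain ⟨h0, h1, h2⟩ := hu.abs_core_le hδ hL hM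
      have hj' := abs_lt.1 (not_le.1 hj)
      have : j = 0 ∨ j = 1 ∨ j = -1 := by omega
      rcases this with rfl | rfl | rfl <;> norm_num <;> linarith
  · rw [hu.eq_zero j (-j ^ 2) fun h => hjL (by have := (abs_le.1 h.2).1; omega), abs_zero]
    positivity

/-- A nonresonant site sees its neighbours through a bound proportional to its own energy. -/
theorem IsNullVector.abs_neighbor_le (hu : IsNullVector δ L u) (hδ : 0 < δ) (hL : 2 ≤ L)
    (hM : ∀ j n : ℤ, n + j ^ 2 ≠ 0 → |u j n| ≤ M) {j n a b : ℤ} (h : n + j ^ 2 ≠ 0)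
    (ha : a = 1 ∨ a = -1) (hb : b = 1 ∨ b = -1) :
    |u (j + a) (n + b)| ≤ 15 * M * |((n + j ^ 2 : ℤ) : ℝ)| := by
  have hM0 : 0 ≤ M := (abs_nonneg _).trans (hM 0 1 (by norm_num))
  have h1 : (1 : ℝ) ≤ |((n + j ^ 2 : ℤ) : ℝ)| := by exact_mod_cast Int.one_le_abs h
  by_cases hres : n + b + (j + a) ^ 2 = 0
  · have hn : n + b = -(j + a) ^ 2 := by omega
    have hlin : 2 * (|j + a| + 1) ≤ 5 * |n + j ^ 2| := by
      have hD : n + j ^ 2 = -b - a ^ 2 - 2 * j * a := by linear_combination hres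
      rw [hD] at h ⊢
      rcases ha with rfl | rfl <;> rcases hb with rfl | rfl <;> ring_nf at h ⊢ <;>
        simp only [abs_eq_max_neg] <;> omega
    have hlin' : 2 * (|((j + a : ℤ) : ℝ)| + 1) ≤ 5 * |((n + j ^ 2 : ℤ) : ℝ)| := by
      exact_mod_cast hlin
    rw [hn]
    have := hu.abs_resonant_le hδ hL hM (j + a)
    nlinarith
  · have := hM _ _ hres
    nlinarith

/-- One step of the contraction on the nonresonant sites. -/
theorem IsNullVector.abs_nonresonant_le (hu : IsNullVector δ L u) (hδ : 0 < δ) (hL : 2 ≤ L)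
    (hM : ∀ j n : ℤ, n + j ^ 2 ≠ 0 → |u j n| ≤ M) {j n : ℤ} (h : n + j ^ 2 ≠ 0) :
    |u j n| ≤ 60 * δ * M := by
  have hM0 : 0 ≤ M := (abs_nonneg _).trans (hM 0 1 (by norm_num))
  by_cases hin : |j| ≤ L ∧ |n| ≤ L
  · have hpos : 0 < |((n + j ^ 2 : ℤ) : ℝ)| := abs_pos.2 (by exact_mod_cast h)
    have e := congrArg abs (hu.eqn j n hin.1 hin.2)
    rw [abs_mul, abs_mul, abs_neg, abs_of_pos hδ] at e
    have k1 := hu.abs_neighbor_le hδ hL hM h (.inl rfl) (.inl rfl)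
    have k2 := hu.abs_neighbor_le hδ hL hM h (.inl rfl) (.inr rfl)
    have k3 := hu.abs_neighbor_le hδ hL hM h (.inr rfl) (.inl rfl)
    have k4 := hu.abs_neighbor_le hδ hL hM h (.inr rfl) (.inr rfl)
    simp only [← sub_eq_add_neg] at k1 k2 k3 k4
    refine le_of_mul_le_mul_left ?_ hpos
    rw [e]
    calc δ * |u (j + 1) (n + 1) + u (j + 1) (n - 1) + u (j - 1) (n + 1) + u (j - 1) (n - 1)|
        ≤ δ * (4 * (15 * M * |((n + j ^ 2 : ℤ) : ℝ)|)) := by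
          gcongr
          refine (abs_add_le _ _).trans ?_
          linarith [abs_add_three (u (j + 1) (n + 1)) (u (j + 1) (n - 1)) (u (j - 1) (n + 1))]
      _ = |((n + j ^ 2 : ℤ) : ℝ)| * (60 * δ * M) := by ring
  · rw [hu.eq_zero j n hin, abs_zero]
    positivity

theorem IsNullVector.eq_zero_of_small (hu : IsNullVector δ L u) (hδ : 0 < δ) (hδ' : 60 * δ < 1)
    (hL : 2 ≤ L) (j n : ℤ) : u j n = 0 := by
  let T := (Finset.Icc (-L) L ×ˢ Finset.Icc (-L) L).filter fun p : ℤ × ℤ => p.2 + p.1 ^ 2 ≠ 0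
  have hT : ((0, 1) : ℤ × ℤ) ∈ T := Finset.mem_filter.2
    ⟨mem_square_iff.2 ⟨abs_le.2 (by omega), abs_le.2 (by omega)⟩, by norm_num⟩
  obtain ⟨⟨a, b⟩, hab, hmax⟩ := T.exists_max_image (fun p => |u p.1 p.2|) ⟨_, hT⟩
  have hM : ∀ j n : ℤ, n + j ^ 2 ≠ 0 → |u j n| ≤ |u a b| := by
    intro j n h
    by_cases hin : |j| ≤ L ∧ |n| ≤ L
    · exact hmax (j, n) (Finset.mem_filter.2 ⟨mem_square_iff.2 hin, h⟩)
    · rw [hu.eq_zero j n hin, abs_zero]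
      exact abs_nonneg _
  have hab0 : |u a b| = 0 := by
    have := hu.abs_nonresonant_le hδ hL hM (Finset.mem_filter.1 hab).2
    nlinarith [abs_nonneg (u a b)]
  rw [hab0] at hM
  rw [← abs_nonpos_iff]
  by_cases h : n + j ^ 2 = 0
  · obtain rfl : n = -j ^ 2 := by omega
    simpa using hu.abs_resonant_le hδ hL hM j
  · exact hM j n h

end

/-- for small `δ`, `0` is not an eigenvalue of `H_Λ` for any square
`Λ = ([−L, L] ∩ ℤ)²` with `L ≥ 8`. -/
theorem zero_not_eigenvalue :
    ∃ δ₀ > (0 : ℝ), ∀ δ : ℝ, 0 < δ → δ < δ₀ →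
      ∀ L : ℤ, 8 ≤ L →
        ¬ IsEigen δ (Finset.Icc (-L) L ×ˢ Finset.Icc (-L) L) 0 := by
  refine ⟨1 / 60, by norm_num, fun δ hδ hδ' L hL ⟨v, hv0, hv⟩ => hv0 ?_⟩
  rw [zero_smul] at hv
  funext p
  have := (isNullVector_extendZero hv).eq_zero_of_small hδ (by linarith) (by omega)
    (p : ℤ × ℤ).1 (p : ℤ × ℤ).2
  exact (dif_pos p.2).symm.trans this
end
end

section
/- For every (j,n) ∈ P with |j| > 1 and every integer L with |j| ≤ L ≤ 2(|j|−1), the square Λ_j = {(j',n') ∈ ℤ×ℤ : max(|j'−j|, |n'−n|) ≤ L} contains exactly one point of P, namely (j,n) itself: Λ_j ∩ P = {(j,n)}. -/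
noncomputable section

/-- the square `Λ_j` (with admissible side length) meets the resonant
parabola `P` only in its center: `Λ_j ∩ P = {(j, n)}`. -/
theorem unique_resonant_site (j n L : ℤ) (hP : n + j ^ 2 = 0) (hj : 1 < |j|)
    (hL1 : |j| ≤ L) (hL2 : L ≤ 2 * (|j| - 1)) :
    ∀ x : ℤ × ℤ, (x ∈ sqΛ j n L ∧ x.2 + x.1 ^ 2 = 0) ↔ x = (j, n) := by
  rintro ⟨a, b⟩
  simp only [sqΛ, Finset.mem_product, Finset.mem_Icc, Prod.mk.injEq]
  constructor
  · rintro ⟨⟨⟨h1, h2⟩, h3, h4⟩, h5⟩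
    have hsq : a ^ 2 = j ^ 2 := by
      rw [← sq_abs a, ← sq_abs j] at *
      have ha := abs_nonneg a
      rcases lt_trichotomy |a| |j| with h | h | h
      · nlinarith
      · rw [h]
      · nlinarith
    have hab : a = j ∨ a = -j := sq_eq_sq_iff_eq_or_eq_neg.mp hsq
    have haj : a = j := by
      rcases hab with h | h
      · exact h
      · rcases abs_cases j with ⟨hj', _⟩ | ⟨hj', _⟩ <;> omega
    exact ⟨haj, by omega⟩
  · rintro ⟨rfl, rfl⟩
    exact ⟨⟨⟨by omega, by omega⟩, by omega, by omega⟩, hP⟩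
end
end
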